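/- Let p be a prime and let G1 and G2 be finite p-groups with G1 abelian. Suppose there is a bijection φ : G1 → G2 such that for every subset X of G1, X is independent in G1 if and only if φ(X) is independent in G2. Then every subgroup H of G2 satisfies d(H) ≤ d(Ω1(H)), where Ω1(H) is the subgroup of H generated by the elements x of H with x^p = 1. -/

import Mathlib

/-- A subset `X` of a group is independent if no element of `X` lies in the
subgroup generated by the other elements of `X`. -/
def Independent {G : Type*} [Group G] (X : Set G) : Prop :=
  ∀ x ∈ X, x ∉ Subgroup.closure (X \ {x})

/-- `dgen H` is the least cardinality of a generating set of the subgroup `H`. -/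
noncomputable def dgen {G : Type*} [Group G] (H : Subgroup G) : ℕ :=
  sInf {n : ℕ | ∃ S : Set G, S.Finite ∧ S ⊆ (H : Set G) ∧ Subgroup.closure S = H ∧ S.ncard = n}

/-- A subset `X` of a group is strongly independent if every subgroup `H` containing `X`
satisfies `|X| ≤ d(H)`. -/
def StronglyIndependent {G : Type*} [Group G] (X : Set G) : Prop :=
  ∀ H : Subgroup G, X ⊆ (H : Set G) → X.ncard ≤ dgen H

/-- A group is hamiltonian if it is nonabelian and all of its subgroups are normal. -/
def IsHamiltonian (G : Type*) [Group G] : Prop :=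
  (∃ a b : G, a * b ≠ b * a) ∧ ∀ H : Subgroup G, H.Normal

open Subgroup

section Independence

variable {G : Type*} [Group G]

theorem independent_singleton_iff {x : G} : Independent ({x} : Set G) ↔ x ≠ 1 := by
  simp [Independent]

theorem not_independent_insert {X : Set G} {g : G} (hg : g ∈ Subgroup.closure X) (hgX : g ∉ X) :
    ¬ Independent (insert g X) := fun h =>
  h g (Set.mem_insert g X) (by simpa [Set.insert_sdiff_of_mem, hgX] using hg)

/-- Two elements are comparable if one of them is a power of the other. -/
def PowComparable (x y : G) : Prop := x ∈ zpowers y ∨ y ∈ zpowers x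

theorem PowComparable.symm {x y : G} (h : PowComparable x y) : PowComparable y x := Or.symm h

theorem independent_pair_iff {x y : G} (hxy : x ≠ y) :
    Independent ({x, y} : Set G) ↔ ¬ PowComparable x y := by
  have h1 : ({x, y} : Set G) \ {x} = {y} := by ext z; simp; grind
  have h2 : ({x, y} : Set G) \ {y} = {x} := by ext z; simp; grind
  simp [Independent, PowComparable, h1, h2, ← zpowers_eq_closure]

variable [Finite G]

theorem dgen_le_ncard {H : Subgroup G} {S : Set G} (hS : Subgroup.closure S = H) :
    dgen H ≤ S.ncard :=
  Nat.sInf_le ⟨S, S.toFinite, hS ▸ Subgroup.subset_closure, hS, rfl⟩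

theorem exists_closure_eq_ncard_eq_dgen (H : Subgroup G) :
    ∃ S : Set G, Subgroup.closure S = H ∧ S.ncard = dgen H := by
  obtain ⟨S, -, -, h, h'⟩ := Nat.sInf_mem (s := {n : ℕ | ∃ S : Set G, S.Finite ∧
    S ⊆ (H : Set G) ∧ Subgroup.closure S = H ∧ S.ncard = n})
    ⟨_, (H : Set G), Set.toFinite _, subset_rfl, Subgroup.closure_eq H, rfl⟩
  exact ⟨S, h, h'⟩

theorem independent_of_ncard_le_dgen {S : Set G} (h : S.ncard ≤ dgen (Subgroup.closure S)) :
    Independent S := by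
  intro s hs hmem
  have h1 : Subgroup.closure (S \ {s}) = Subgroup.closure S := by
    refine le_antisymm (Subgroup.closure_mono Set.sdiff_subset)
      ((Subgroup.closure_le _).2 fun x hx => ?_)
    by_cases hxs : x = s
    · exact hxs ▸ hmem
    · exact Subgroup.subset_closure ⟨hx, hxs⟩
  have h2 := dgen_le_ncard h1
  have h3 := Set.ncard_sdiff_singleton_lt_of_mem hs S.toFinite
  omega

theorem dgen_sup_zpowers_le (M : Subgroup G) (c : G) : dgen (M ⊔ zpowers c) ≤ dgen M + 1 := by
  obtain ⟨S, hS, hn⟩ := exists_closure_eq_ncard_eq_dgen M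
  refine (dgen_le_ncard (S := insert c S) ?_).trans (hn ▸ Set.ncard_insert_le c S)
  rw [Set.insert_eq, Subgroup.closure_union, hS, ← zpowers_eq_closure, sup_comm]

end Independence

section Zpowers

variable {G : Type*} [Group G]

theorem mem_of_pow_mem_of_zpow_mem {K : Subgroup G} {y : G} {n : ℕ} {k : ℤ}
    (h : IsCoprime (n : ℤ) k) (hn : y ^ n ∈ K) (hk : y ^ k ∈ K) : y ∈ K := by
  obtain ⟨a, b, hab⟩ := h
  have : y = (y ^ n) ^ a * (y ^ k) ^ b := by
    rw [← zpow_natCast, ← zpow_mul, ← zpow_mul, ← zpow_add, mul_comm, mul_comm k, hab, zpow_one]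
  rw [this]
  exact mul_mem (zpow_mem hn a) (zpow_mem hk b)

theorem mem_of_zpow_mem_of_not_dvd {p : ℕ} (hp : p.Prime) {K : Subgroup G} {y : G} {k : ℤ}
    (h : ¬ (p : ℤ) ∣ k) (hn : y ^ p ∈ K) (hk : y ^ k ∈ K) : y ∈ K :=
  mem_of_pow_mem_of_zpow_mem ((Nat.prime_iff_prime_int.1 hp).coprime_iff_not_dvd.2 h) hn hk

theorem zpow_eq_one_of_dvd {p : ℕ} {y : G} {k : ℤ} (h : (p : ℤ) ∣ k) (hy : y ^ p = 1) :
    y ^ k = 1 := by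
  obtain ⟨c, rfl⟩ := h
  rw [zpow_mul, zpow_natCast, hy, one_zpow]

theorem pow_eq_one_of_mem_zpowers {p : ℕ} {x y : G} (h : x ∈ zpowers y) (hy : y ^ p = 1) :
    x ^ p = 1 := by
  obtain ⟨k, rfl⟩ := mem_zpowers_iff.1 h
  rw [← zpow_natCast, ← zpow_mul, mul_comm, zpow_mul, zpow_natCast, hy, one_zpow]

theorem mem_zpowers_symm {p : ℕ} (hp : p.Prime) {x y : G} (h : x ∈ zpowers y) (hy : y ^ p = 1)
    (hx : x ≠ 1) : y ∈ zpowers x := by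
  obtain ⟨k, rfl⟩ := mem_zpowers_iff.1 h
  exact mem_of_zpow_mem_of_not_dvd hp (fun hd => hx (zpow_eq_one_of_dvd hd hy)) (hy ▸ one_mem _)
    (mem_zpowers _)

theorem PowComparable.mem_zpowers {p : ℕ} (hp : p.Prime) {x y : G} (h : PowComparable x y)
    (hx : x ^ p = 1) (hy : y ≠ 1) : x ∈ zpowers y :=
  h.elim id fun h => mem_zpowers_symm hp h hx hy

theorem mem_zpowers_of_mem_zpowers_of_pow_eq_one [Finite G] {p : ℕ} (hp : p.Prime) {x e e' : G}
    (he : e ∈ zpowers x) (he' : e' ∈ zpowers x) (h : e ^ p = 1) (h' : e' ^ p = 1)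
    (hne : e' ≠ 1) : e ∈ zpowers e' := by
  have := Fact.mk hp
  let _ : CommGroup (zpowers x) := IsCyclic.commGroup
  let a : zpowers x := ⟨e, he⟩
  let b : zpowers x := ⟨e', he'⟩
  have hb : b ^ p = 1 := Subtype.ext h'
  have hle : zpowers b ≤ (powMonoidHom p : zpowers x →* zpowers x).ker := by
    rw [zpowers_le, MonoidHom.mem_ker]; exact hb
  have heq := eq_of_le_of_card_ge hle (by
    rw [IsCyclic.card_powMonoidHom_ker, Nat.card_zpowers b,
      orderOf_eq_prime hb fun hb => hne (congrArg Subtype.val hb)]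
    exact Nat.gcd_le_right _ hp.pos)
  have ha : a ∈ zpowers b := by
    rw [heq, MonoidHom.mem_ker]; exact Subtype.ext h
  obtain ⟨k, hk⟩ := mem_zpowers_iff.1 ha
  exact mem_zpowers_iff.2 ⟨k, congrArg Subtype.val hk⟩

theorem IsPGroup.exists_mem_zpowers_pow_eq_one {p : ℕ} (hG : IsPGroup p G) {y : G} (hy : y ≠ 1) :
    ∃ e ∈ zpowers y, e ≠ 1 ∧ e ^ p = 1 := by
  classical
  have h := hG y
  obtain ⟨k, hk⟩ : ∃ k, Nat.find h = k + 1 := Nat.exists_eq_succ_of_ne_zero fun h0 => by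
    have := Nat.find_spec h
    rw [h0] at this
    exact hy (by simpa using this)
  refine ⟨y ^ p ^ k, npow_mem_zpowers y _, Nat.find_min h (by omega), ?_⟩
  rw [← pow_mul, ← pow_succ, ← hk]
  exact Nat.find_spec h

theorem mem_sup_zpowers [Finite G] {L : Subgroup G} {y : G} (hy : ∀ l ∈ L, y * l * y⁻¹ ∈ L)
    {x : G} : x ∈ L ⊔ zpowers y ↔ ∃ l ∈ L, ∃ k : ℤ, x = l * y ^ k := by
  have hN : zpowers y ≤ normalizer (L : Set G) :=
    zpowers_le.2 (mem_normalizer_fintype (S := (L : Set G)) hy)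
  rw [← SetLike.mem_coe, coe_mul_of_right_le_normalizer_left L _ hN, Set.mem_mul]
  constructor
  · rintro ⟨l, hl, z, ⟨k, rfl⟩, rfl⟩
    exact ⟨l, hl, k, rfl⟩
  · rintro ⟨l, hl, k, rfl⟩
    exact ⟨l, hl, _, ⟨k, rfl⟩, rfl⟩

theorem card_sup_zpowers_le [Finite G] {p : ℕ} (hp : 0 < p) {L : Subgroup G} {y : G}
    (hy : ∀ l ∈ L, y * l * y⁻¹ ∈ L) (hyp : y ^ p ∈ L) :
    Nat.card ↥(L ⊔ zpowers y) ≤ p * Nat.card L := by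
  have : Function.Surjective (fun q : Fin p × L => (⟨q.2 * y ^ (q.1 : ℕ),
      (mem_sup_zpowers hy).2 ⟨q.2, q.2.2, (q.1 : ℕ), by rw [zpow_natCast]⟩⟩ :
        ↥(L ⊔ zpowers y))) := by
    rintro ⟨x, hx⟩
    obtain ⟨l, hl, k, rfl⟩ := (mem_sup_zpowers hy).1 hx
    have hk0 : 0 ≤ k % p := Int.emod_nonneg _ (by omega)
    refine ⟨⟨⟨(k % p).toNat, by have := Int.emod_lt_of_pos k (b := p) (by omega); omega⟩,
      ⟨l * (y ^ p) ^ (k / p), mul_mem hl (zpow_mem hyp _)⟩⟩, Subtype.ext ?_⟩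
    change l * (y ^ p) ^ (k / p) * y ^ (k % p).toNat = l * y ^ k
    rw [mul_assoc, ← zpow_natCast y (k % p).toNat, Int.toNat_of_nonneg hk0, ← zpow_natCast y p,
      ← zpow_mul, ← zpow_add, Int.mul_ediv_add_emod]
  simpa [Nat.card_prod] using Nat.card_le_card_of_surjective _ this

end Zpowers

section PGroup

variable {G : Type*} [Group G] [Finite G] {p : ℕ} [Fact p.Prime]

theorem IsPGroup.mul_card_le_of_lt (hG : IsPGroup p G) {K L : Subgroup G} (h : K < L) :
    p * Nat.card K ≤ Nat.card L := by
  obtain ⟨n, hn⟩ := (hG.to_subgroup L).index (K.subgroupOf L)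
  have h1 := card_mul_index (K.subgroupOf L)
  rw [Nat.card_congr (subgroupOfEquivOfLe h.le).toEquiv, hn] at h1
  have hn0 : n ≠ 0 := by
    rintro rfl
    exact h.not_ge (relIndex_eq_one.1 (by simpa [relIndex] using hn))
  rw [← h1, mul_comm]
  exact Nat.mul_le_mul_left _ (Nat.le_self_pow hn0 p)

theorem IsPGroup.exists_mem_conj_mem (hG : IsPGroup p G) {H L : Subgroup G} (h : H < L) :
    ∃ f ∈ L, f ∉ H ∧ ∀ x ∈ H, f * x * f⁻¹ ∈ H := by
  have := (hG.to_subgroup L).isNilpotent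
  have hlt := Group.normalizerCondition_of_isNilpotent (H.subgroupOf L) (by
    rw [lt_top_iff_ne_top, Ne, subgroupOf_eq_top]; exact h.not_ge)
  obtain ⟨f, hf, hfH⟩ := SetLike.exists_of_lt hlt
  refine ⟨f, f.2, hfH, fun x hx => ?_⟩
  exact (mem_normalizer_iff.1 hf ⟨x, h.le hx⟩).1 hx

theorem IsPGroup.conj_mem_of_covBy (hG : IsPGroup p G) {M K : Subgroup G} (h : M ⋖ K) {k m : G}
    (hk : k ∈ K) (hm : m ∈ M) : k * m * k⁻¹ ∈ M := by
  obtain ⟨f, hfK, hfM, hf⟩ := hG.exists_mem_conj_mem h.lt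
  have hlt : M < normalizer (M : Set G) ⊓ K := by
    refine lt_of_le_of_ne (le_inf le_normalizer h.le) fun heq => hfM ?_
    rw [heq]
    exact ⟨mem_normalizer_fintype (S := (M : Set G)) hf, hfK⟩
  have := (h.eq_or_eq hlt.le inf_le_right).resolve_left hlt.ne'
  rw [← this] at hk
  exact (mem_normalizer_iff.1 hk.1 m).1 hm

omit [Finite G] in
theorem sup_zpowers_eq_of_covBy {M K : Subgroup G} (h : M ⋖ K) {c : G} (hc : c ∈ K)
    (hcM : c ∉ M) : M ⊔ zpowers c = K :=
  (h.eq_or_eq le_sup_left (sup_le h.le (zpowers_le.2 hc))).resolve_left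
    (left_lt_sup.2 fun hle : zpowers c ≤ M => hcM (hle (mem_zpowers c))).ne'

theorem IsPGroup.pow_mem_of_covBy (hG : IsPGroup p G) {M K : Subgroup G} (h : M ⋖ K) {y : G}
    (hy : y ∈ K) : y ^ p ∈ M := by
  by_contra hyp
  have hK := sup_zpowers_eq_of_covBy h (pow_mem hy p) hyp
  have hy' := hy
  rw [← hK, mem_sup_zpowers fun l hl => hG.conj_mem_of_covBy h (pow_mem hy p) hl] at hy'
  obtain ⟨m, hm, k, hk⟩ := hy'
  obtain ⟨j, hj⟩ := hG y
  refine hyp (pow_mem (mem_of_pow_mem_of_zpow_mem (n := p ^ j) (k := 1 - p * k) ?_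
    (hj ▸ one_mem _) ?_) p)
  · push_cast
    exact IsCoprime.pow_left ⟨k, 1, by ring⟩
  · have : y ^ (1 - p * k : ℤ) = m := by
      rw [zpow_sub, zpow_one, zpow_mul, zpow_natCast, mul_inv_eq_iff_eq_mul]
      exact hk
    rwa [this]

theorem IsPGroup.commutator_mem_of_covBy (hG : IsPGroup p G) {M K : Subgroup G} (h : M ⋖ K)
    {a b : G} (ha : a ∈ K) (hb : b ∈ K) : a * b * a⁻¹ * b⁻¹ ∈ M := by
  by_cases haM : a ∈ M
  · have := mul_mem haM (hG.conj_mem_of_covBy h hb (inv_mem haM))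
    simpa only [mul_assoc] using this
  · rw [← sup_zpowers_eq_of_covBy h ha haM,
      mem_sup_zpowers fun l hl => hG.conj_mem_of_covBy h ha hl] at hb
    obtain ⟨m, hm, k, rfl⟩ := hb
    have := mul_mem (hG.conj_mem_of_covBy h ha hm) (inv_mem hm)
    convert this using 1
    group

/-- The intersection of `K` with its maximal subgroups. -/
def frattiniIn (K : Subgroup G) : Subgroup G := sInf (insert K {M | M ⋖ K})

omit [Finite G] in
theorem mem_frattiniIn {K : Subgroup G} {x : G} :
    x ∈ frattiniIn K ↔ x ∈ K ∧ ∀ M, M ⋖ K → x ∈ M := by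
  simp [frattiniIn, mem_sInf]

theorem eq_of_sup_eq_of_le_frattiniIn {K L N : Subgroup G} (hN : N ≤ frattiniIn K)
    (h : L ⊔ N = K) : L = K := by
  by_contra hne
  obtain ⟨M, hLM, hM⟩ := exists_le_covBy_of_lt (lt_of_le_of_ne (h ▸ le_sup_left : L ≤ K) hne)
  have hle : L ⊔ N ≤ M := sup_le hLM fun x hx => (mem_frattiniIn.1 (hN hx)).2 M hM
  exact hM.lt.not_ge (h ▸ hle)

theorem IsPGroup.pow_ncard_mul_card_le_of_independent (hG : IsPGroup p G) {K N : Subgroup G}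
    (hN : N ≤ frattiniIn K) {X : Set G} (hX : Independent X) (hXK : Subgroup.closure X = K) :
    p ^ X.ncard * Nat.card N ≤ Nat.card K := by
  have hNK : N ≤ K := fun x hx => (mem_frattiniIn.1 (hN hx)).1
  have key : p ^ X.ncard * Nat.card N ≤ Nat.card ↥(Subgroup.closure X ⊔ N) := by
    refine Set.Finite.induction_on_subset
      (motive := fun Y _ => p ^ Y.ncard * Nat.card N ≤ Nat.card ↥(Subgroup.closure Y ⊔ N))
      X X.toFinite ?_ ?_
    · simp
    · intro a Y ha hY haY ih
      rw [Set.ncard_insert_of_notMem haY, pow_succ', mul_assoc]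
      refine (Nat.mul_le_mul_left p ih).trans (hG.mul_card_le_of_lt ?_)
      refine lt_of_le_of_ne
        (sup_le_sup_right (Subgroup.closure_mono (Set.subset_insert _ _)) N) fun heq => ?_
      have haN : a ∈ Subgroup.closure Y ⊔ N := by
        rw [heq]; exact mem_sup_left (Subgroup.subset_closure (Set.mem_insert _ _))
      have hYX : Y ⊆ X \ {a} := fun y hy => ⟨hY hy, fun h => haY (h ▸ hy)⟩
      have hsup : Subgroup.closure (X \ {a}) ⊔ N = K := by
        refine le_antisymm (sup_le (hXK ▸ Subgroup.closure_mono Set.sdiff_subset) hNK) ?_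
        rw [← hXK, Subgroup.closure_le]
        intro x hx
        by_cases hxa : x = a
        · exact hxa ▸ (sup_le_sup_right (Subgroup.closure_mono hYX) N) haN
        · exact mem_sup_left (Subgroup.subset_closure ⟨hx, hxa⟩)
      refine hX a ha ?_
      rw [eq_of_sup_eq_of_le_frattiniIn hN hsup, ← hXK]
      exact Subgroup.subset_closure ha
  rwa [hXK, sup_eq_left.2 hNK] at key

omit [Fact p.Prime] in
theorem card_closure_sup_le {N : Subgroup G} {Y : Set G} (hp : 0 < p)
    (hc : ∀ a ∈ Subgroup.closure Y ⊔ N, ∀ b ∈ Subgroup.closure Y ⊔ N, a * b * a⁻¹ * b⁻¹ ∈ N)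
    (hpow : ∀ y ∈ Y, y ^ p ∈ N) :
    Nat.card ↥(Subgroup.closure Y ⊔ N) ≤ p ^ Y.ncard * Nat.card N := by
  refine Set.Finite.induction_on_subset
    (motive := fun Z _ => Nat.card ↥(Subgroup.closure Z ⊔ N) ≤ p ^ Z.ncard * Nat.card N)
    Y Y.toFinite ?_ ?_
  · simp
  · intro a Z ha hZ haZ ih
    rw [Set.ncard_insert_of_notMem haZ, pow_succ', mul_assoc]
    have heq : Subgroup.closure (insert a Z) ⊔ N = (Subgroup.closure Z ⊔ N) ⊔ zpowers a := by
      rw [Set.insert_eq, Subgroup.closure_union, ← zpowers_eq_closure]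
      ac_rfl
    rw [heq]
    refine (card_sup_zpowers_le hp (fun l hl => ?_) (mem_sup_right (hpow a ha))).trans
      (Nat.mul_le_mul_left p ih)
    have := mul_mem (mem_sup_right (hc a (mem_sup_left (Subgroup.subset_closure ha)) l
      (sup_le_sup_right (Subgroup.closure_mono hZ) N hl)) : _ ∈ Subgroup.closure Z ⊔ N) hl
    simpa using this

theorem IsPGroup.ncard_le_dgen_of_independent (hG : IsPGroup p G) {X : Set G}
    (hX : Independent X) : X.ncard ≤ dgen (Subgroup.closure X) := by
  obtain ⟨Y, hY, hn⟩ := exists_closure_eq_ncard_eq_dgen (Subgroup.closure X)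
  have h1 := hG.pow_ncard_mul_card_le_of_independent le_rfl hX rfl
  have hle : frattiniIn (Subgroup.closure X) ≤ Subgroup.closure X :=
    fun x hx => (mem_frattiniIn.1 hx).1
  have hsup : Subgroup.closure Y ⊔ frattiniIn (Subgroup.closure X) = Subgroup.closure X := by
    rw [hY, sup_eq_left.2 hle]
  have hp := (Fact.out : p.Prime)
  have h2 := card_closure_sup_le (p := p) (N := frattiniIn (Subgroup.closure X)) (Y := Y) hp.pos (by
    rw [hsup]
    intro a ha b hb
    exact mem_frattiniIn.2 ⟨mul_mem (mul_mem (mul_mem ha hb) (inv_mem ha)) (inv_mem hb),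
      fun M hM => hG.commutator_mem_of_covBy hM ha hb⟩) (by
    intro y hy
    have hy' : y ∈ Subgroup.closure X := hY ▸ Subgroup.subset_closure hy
    exact mem_frattiniIn.2 ⟨pow_mem hy' p, fun M hM => hG.pow_mem_of_covBy hM hy'⟩)
  rw [hsup] at h2
  rw [← hn]
  exact (Nat.pow_le_pow_iff_right hp.one_lt).1
    (Nat.le_of_mul_le_mul_right (h1.trans h2) Nat.card_pos)

omit [Fact p.Prime] in
theorem card_closure_le_pow {Y : Set G} (hp : 0 < p)
    (hc : ∀ a ∈ Subgroup.closure Y, ∀ b ∈ Subgroup.closure Y, a * b = b * a)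
    (hpow : ∀ y ∈ Y, y ^ p = 1) :
    Nat.card ↥(Subgroup.closure Y) ≤ p ^ Y.ncard := by
  have := card_closure_sup_le (p := p) (N := ⊥) (Y := Y) hp (by
    rw [sup_bot_eq]
    intro a ha b hb
    rw [hc a ha b hb, mem_bot]; group) (fun y hy => mem_bot.2 (hpow y hy))
  rw [sup_bot_eq] at this
  simpa using this

end PGroup

section CommGroup

variable {G : Type*} [CommGroup G] [Finite G] {p : ℕ}

theorem independent_insert_of_notMem_closure (hp : p.Prime) {T : Set G} {e : G}
    (hT : Independent T) (he : e ^ p = 1) (h : e ∉ Subgroup.closure T) :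
    Independent (insert e T) := by
  have heT : e ∉ T := fun h' => h (Subgroup.subset_closure h')
  intro x hx hmem
  rcases hx with rfl | hx
  · exact h (by simpa [heT] using hmem)
  · have hex : e ∉ ({x} : Set G) := fun h' => heT (h' ▸ hx)
    rw [Set.insert_sdiff_of_notMem _ hex, Set.insert_eq, Subgroup.closure_union,
      ← zpowers_eq_closure, sup_comm, mem_sup_zpowers (by simp)] at hmem
    obtain ⟨l, hl, k, hk⟩ := hmem
    by_cases hd : (p : ℤ) ∣ k
    · rw [zpow_eq_one_of_dvd hd he, mul_one] at hk
      exact hT x hx (hk ▸ hl)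
    · refine h (mem_of_zpow_mem_of_not_dvd hp hd (he ▸ one_mem _) ?_)
      rw [eq_inv_mul_of_mul_eq hk.symm]
      exact mul_mem (inv_mem (Subgroup.closure_mono Set.sdiff_subset hl))
        (Subgroup.subset_closure hx)

theorem IsPGroup.pow_ncard_le_card_ker_inf_closure [Fact p.Prime] (hG : IsPGroup p G) {T : Set G}
    (hT : Independent T) :
    p ^ T.ncard ≤ Nat.card ↥((powMonoidHom p : G →* G).ker ⊓ Subgroup.closure T) := by
  set K := Subgroup.closure T with hK
  set f : K →* G := (powMonoidHom p).comp K.subtype with hf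
  have h1 := hG.pow_ncard_mul_card_le_of_independent (K := K) (N := f.range) (by
    rintro _ ⟨x, rfl⟩
    exact mem_frattiniIn.2 ⟨pow_mem x.2 p, fun M hM => hG.pow_mem_of_covBy hM x.2⟩) hT rfl
  have h2 := card_mul_index f.ker
  rw [index_ker] at h2
  have h3 : f.ker = ((powMonoidHom p : G →* G).ker ⊓ K).subgroupOf K := by
    ext x
    simp [hf, MonoidHom.mem_ker, mem_subgroupOf]
  rw [h3, Nat.card_congr (subgroupOfEquivOfLe inf_le_right).toEquiv] at h2
  exact Nat.le_of_mul_le_mul_right (h1.trans h2.symm.le) Nat.card_pos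

end CommGroup

section Bijection

variable {G₁ G₂ : Type*} [CommGroup G₁] [Finite G₁] [Group G₂] [Finite G₂] {p : ℕ}
  {φ : G₁ ≃ G₂}

omit [Finite G₁] [Finite G₂] in
theorem powComparable_map_iff (hφ : ∀ X : Set G₁, Independent X ↔ Independent (φ '' X))
    {x y : G₁} : PowComparable (φ x) (φ y) ↔ PowComparable x y := by
  by_cases hxy : x = y
  · subst hxy
    exact ⟨fun _ => Or.inl (mem_zpowers x), fun _ => Or.inl (mem_zpowers _)⟩
  · have := hφ {x, y}
    rw [Set.image_pair, independent_pair_iff hxy, independent_pair_iff (φ.injective.ne hxy)] at this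
    exact (not_iff_not.1 this).symm

omit [Finite G₁] [Finite G₂] in
theorem map_one_of_independent_iff (hφ : ∀ X : Set G₁, Independent X ↔ Independent (φ '' X)) :
    φ 1 = 1 := by
  have := hφ {1}
  rw [Set.image_singleton, independent_singleton_iff, independent_singleton_iff] at this
  exact not_not.1 fun h => this.2 h rfl

variable [Fact p.Prime]

theorem pow_eq_one_of_powComparable
    (h₁ : IsPGroup p G₁) (h₂ : IsPGroup p G₂)
    (hφ : ∀ X : Set G₁, Independent X ↔ Independent (φ '' X))
    (hV : p < Nat.card (powMonoidHom p : G₁ →* G₁).ker) {e e' : G₁} (he : e ^ p = 1) (hne : e ≠ 1)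
    (hge : φ e' ^ p = 1) (hne' : e' ≠ 1) (hee : φ e' ∈ zpowers (φ e)) : e' ^ p = 1 := by
  have hp := (Fact.out : p.Prime)
  by_contra hep
  have hφ1 := map_one_of_independent_iff hφ
  have hg1 : φ e' ≠ 1 := fun h => hne' (φ.injective (h.trans hφ1.symm))
  obtain ⟨v, hv, hve⟩ : ∃ v : G₁, v ^ p = 1 ∧ v ∉ zpowers e := by
    by_contra! h
    have hle : (powMonoidHom p : G₁ →* G₁).ker ≤ zpowers e := fun v hv => h v hv
    have := Nat.card_le_card_of_injective _ (inclusion_injective hle)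
    rw [Nat.card_zpowers, orderOf_eq_prime he hne] at this
    omega
  have hee' : e ∈ zpowers e' :=
    ((powComparable_map_iff hφ).1 (Or.inr hee)).mem_zpowers hp he hne'
  obtain ⟨d, hd, hd1, hdp⟩ := h₁.exists_mem_zpowers_pow_eq_one hep
  have hd' : d ∈ zpowers e' := zpowers_le.2 (npow_mem_zpowers e' p) hd
  have hd'' : d ∈ zpowers (e' * v) := by
    refine zpowers_le.2 ?_ hd
    have := npow_mem_zpowers (e' * v) p
    rwa [mul_pow, hv, mul_one] at this
  have hev : e ∈ zpowers (e' * v) :=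
    zpowers_le.2 hd'' (mem_zpowers_of_mem_zpowers_of_pow_eq_one hp hee' hd' he hdp hd1)
  have hev1 : e' * v ≠ 1 := fun h => hne (by
    rw [h, zpowers_one_eq_bot, mem_bot] at hev; exact hev)
  have hfv : φ e ∈ zpowers (φ (e' * v)) ∨ φ (e' * v) ∈ zpowers (φ e) :=
    (powComparable_map_iff hφ).2 (Or.inl hev)
  have hcmp : PowComparable e' (e' * v) := by
    refine (powComparable_map_iff hφ).1 (Or.inl ?_)
    rcases hfv with h | h
    · exact zpowers_le.2 h hee
    · obtain ⟨a, ha, ha1, hap⟩ :=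
        h₂.exists_mem_zpowers_pow_eq_one
          (fun h => hev1 (φ.injective (h.trans hφ1.symm)) : φ (e' * v) ≠ 1)
      exact zpowers_le.2 ha (mem_zpowers_of_mem_zpowers_of_pow_eq_one hp hee
        (zpowers_le.2 h ha) hge hap ha1)
  rcases hcmp with h | h
  · refine hve (mem_zpowers_of_mem_zpowers_of_pow_eq_one hp (x := e' * v) ?_ hev hv he hne)
    simpa using mul_mem (inv_mem h) (mem_zpowers (e' * v))
  · refine hve (mem_zpowers_of_mem_zpowers_of_pow_eq_one hp (x := e') ?_ hee' hv he hne)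
    simpa using mul_mem (inv_mem (mem_zpowers e')) h

section LargeTorsion

variable (h₁ : IsPGroup p G₁) (h₂ : IsPGroup p G₂)
  (hφ : ∀ X : Set G₁, Independent X ↔ Independent (φ '' X))
  (hV : p < Nat.card (powMonoidHom p : G₁ →* G₁).ker)
include h₁ h₂ hφ hV

theorem pow_eq_one_of_map_pow_eq_one {x : G₁} (h : φ x ^ p = 1) : x ^ p = 1 := by
  by_cases hx : x = 1
  · rw [hx, one_pow]
  obtain ⟨e, he, he1, hep⟩ := h₁.exists_mem_zpowers_pow_eq_one hx
  refine pow_eq_one_of_powComparable h₁ h₂ hφ hV hep he1 h hx ?_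
  refine PowComparable.mem_zpowers (Fact.out : p.Prime) ((powComparable_map_iff hφ).2 (Or.inr he)) h
    fun h => he1 (φ.injective (h.trans (map_one_of_independent_iff hφ).symm))

theorem symm_pow_eq_one {g : G₂} (h : g ^ p = 1) : φ.symm g ^ p = 1 :=
  pow_eq_one_of_map_pow_eq_one h₁ h₂ hφ hV (by rwa [φ.apply_symm_apply])

theorem symm_mem_zpowers {x : G₁} {g : G₂} (hgp : g ^ p = 1) (hg : g ∈ zpowers (φ x)) :
    φ.symm g ∈ zpowers x := by
  by_cases hx : x = 1
  · subst hx
    rw [map_one_of_independent_iff hφ, zpowers_one_eq_bot, mem_bot] at hg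
    rw [hg, φ.symm_apply_eq.2 (map_one_of_independent_iff hφ).symm]
    exact one_mem _
  · refine PowComparable.mem_zpowers (Fact.out : p.Prime) ?_ (symm_pow_eq_one h₁ h₂ hφ hV hgp) hx
    rw [← powComparable_map_iff hφ, φ.apply_symm_apply]
    exact Or.inl hg

theorem map_pow_eq_one {x : G₁} (h : x ^ p = 1) : φ x ^ p = 1 := by
  have hφ1 := map_one_of_independent_iff hφ
  by_cases hx : x = 1
  · rw [hx, hφ1, one_pow]
  obtain ⟨g, hg, hg1, hgp⟩ := h₂.exists_mem_zpowers_pow_eq_one (y := φ x)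
    fun h => hx (φ.injective (h.trans hφ1.symm))
  let s : zpowers g → zpowers x := fun u => ⟨φ.symm u,
    symm_mem_zpowers h₁ h₂ hφ hV (pow_eq_one_of_mem_zpowers u.2 hgp) (zpowers_le.2 hg u.2)⟩
  have hs : Function.Injective s := fun u v huv =>
    Subtype.ext (φ.symm.injective (congrArg Subtype.val huv))
  have hbij := (Nat.bijective_iff_injective_and_card s).2 ⟨hs, by
    rw [Nat.card_zpowers, Nat.card_zpowers, orderOf_eq_prime hgp hg1, orderOf_eq_prime h hx]⟩
  obtain ⟨u, hu⟩ := hbij.2 ⟨x, mem_zpowers x⟩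
  have : φ x = u := by
    rw [← φ.apply_symm_apply (u : G₂)]
    exact congrArg φ (congrArg Subtype.val hu).symm
  rw [this]
  exact pow_eq_one_of_mem_zpowers u.2 hgp

theorem symm_mem_closure {T : Set G₁} (hT : Independent T) {g : G₂} (hgp : g ^ p = 1)
    (hg : g ∈ Subgroup.closure (φ '' T)) : φ.symm g ∈ Subgroup.closure T := by
  by_contra h
  have hi := independent_insert_of_notMem_closure (Fact.out : p.Prime) hT
    (symm_pow_eq_one h₁ h₂ hφ hV hgp) h
  rw [hφ, Set.image_insert_eq, φ.apply_symm_apply] at hi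
  refine not_independent_insert hg ?_ hi
  rintro ⟨t, ht, rfl⟩
  exact h (by simpa using Subgroup.subset_closure ht)

theorem map_mem_zpowers {x y : G₁} (hx : x ^ p = 1) (hxy : x ∈ zpowers y) :
    φ x ∈ zpowers (φ y) := by
  have hφ1 := map_one_of_independent_iff hφ
  by_cases hy : y = 1
  · subst hy
    rw [zpowers_one_eq_bot, mem_bot] at hxy
    exact hxy ▸ mem_zpowers _
  · exact ((powComparable_map_iff hφ).2 (Or.inl hxy)).mem_zpowers (Fact.out : p.Prime)
      (map_pow_eq_one h₁ h₂ hφ hV hx) fun h => hy (φ.injective (h.trans hφ1.symm))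

theorem commute_and_symm_mul_mem_of_mem_zpowers {x y : G₁} (hx : x ^ p = 1) (hy : y ^ p = 1)
    (hxy : x ∈ zpowers y) :
    Commute (φ x) (φ y) ∧ φ.symm (φ x * φ y) ∈ Subgroup.closure {x, y} := by
  have hf := map_mem_zpowers h₁ h₂ hφ hV hx hxy
  refine ⟨?_, ?_⟩
  · obtain ⟨k, hk⟩ := mem_zpowers_iff.1 hf
    exact hk ▸ Commute.zpow_self (φ y) k
  · have hm := mul_mem hf (mem_zpowers (φ y))
    have := symm_mem_zpowers h₁ h₂ hφ hV
      (pow_eq_one_of_mem_zpowers hm (map_pow_eq_one h₁ h₂ hφ hV hy)) hm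
    exact zpowers_le.2 (Subgroup.subset_closure (by simp)) this

theorem commute_and_symm_mul_mem_of_commute {x y : G₁} (hx : x ^ p = 1) (hy : y ^ p = 1)
    (hxy : Independent {x, y}) {z : G₂} (hz : z ∈ Subgroup.closure {φ x, φ y})
    (hzp : z ^ p = 1) (hzx : Commute z (φ x)) (hzc : ¬ PowComparable z (φ x)) :
    Commute (φ x) (φ y) ∧ φ.symm (φ x * φ y) ∈ Subgroup.closure {x, y} := by
  have hp := (Fact.out : p.Prime)
  set W := zpowers (φ x) ⊔ zpowers z with hW
  have hmem : ∀ g, g ∈ W → ∃ i k : ℤ, g = φ x ^ i * z ^ k := by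
    intro g hg
    rw [hW, mem_sup_zpowers] at hg
    · obtain ⟨l, hl, k, rfl⟩ := hg
      obtain ⟨i, rfl⟩ := mem_zpowers_iff.1 hl
      exact ⟨i, k, rfl⟩
    · intro l hl
      obtain ⟨i, rfl⟩ := mem_zpowers_iff.1 hl
      rw [(hzx.zpow_right i).eq, mul_inv_cancel_right]
      exact hl
  have hcomm : ∀ a ∈ W, ∀ b ∈ W, Commute a b := by
    intro a ha b hb
    obtain ⟨i, k, rfl⟩ := hmem a ha
    obtain ⟨j, l, rfl⟩ := hmem b hb
    exact ((Commute.zpow_zpow_self (φ x) i j).mul_right (hzx.symm.zpow_zpow i l)).mul_left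
      ((hzx.zpow_zpow k j).mul_right (Commute.zpow_zpow_self z k l))
  have hfx := map_pow_eq_one h₁ h₂ hφ hV hx
  have hpow : ∀ a ∈ W, a ^ p = 1 := by
    intro a ha
    obtain ⟨i, k, rfl⟩ := hmem a ha
    rw [(hzx.symm.zpow_zpow i k).mul_pow, pow_eq_one_of_mem_zpowers (zpow_mem_zpowers _ i) hfx,
      pow_eq_one_of_mem_zpowers (zpow_mem_zpowers _ k) hzp, one_mul]
  have hzE : φ.symm z ∈ Subgroup.closure {x, y} :=
    symm_mem_closure h₁ h₂ hφ hV hxy hzp (by rwa [Set.image_pair])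
  have hne : φ.symm z ≠ x := by
    intro h
    rw [φ.symm_apply_eq] at h
    exact hzc (h ▸ Or.inl (mem_zpowers _))
  have hind : Independent {φ.symm z, x} := by
    rw [independent_pair_iff hne, ← powComparable_map_iff hφ, φ.apply_symm_apply]
    exact hzc
  have hWE : ∀ g ∈ W, φ.symm g ∈ Subgroup.closure {x, y} := by
    intro g hg
    have hle : Subgroup.closure {φ.symm z, x} ≤ Subgroup.closure {x, y} := by
      rw [Subgroup.closure_le]
      rintro _ (rfl | rfl)
      · exact hzE
      · exact Subgroup.subset_closure (by simp)
    refine hle (symm_mem_closure h₁ h₂ hφ hV hind (hpow g hg) ?_)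
    rw [Set.image_pair, φ.apply_symm_apply]
    refine sup_le (zpowers_le.2 (Subgroup.subset_closure (by simp)))
      (zpowers_le.2 (Subgroup.subset_closure (by simp))) hg
  have hφx1 : φ x ≠ 1 := fun h => hzc (Or.inr (h ▸ one_mem _))
  have hcardW : p ^ 2 ≤ Nat.card W := by
    have := h₂.mul_card_le_of_lt (K := zpowers (φ x)) (L := W)
      (left_lt_sup.2 fun h => hzc (Or.inl (h (mem_zpowers z))))
    rwa [Nat.card_zpowers, orderOf_eq_prime hfx hφx1, ← sq] at this
  have hcardE : Nat.card (Subgroup.closure {x, y}) ≤ p ^ 2 := by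
    refine (card_closure_le_pow hp.pos (fun a _ b _ => mul_comm a b) ?_).trans
      (Nat.pow_le_pow_right hp.pos ((Set.ncard_insert_le x {y}).trans (by simp)))
    rintro _ (rfl | rfl) <;> assumption
  let s : W → Subgroup.closure {x, y} := fun g => ⟨φ.symm g, hWE g g.2⟩
  have hs : Function.Injective s := fun u v huv =>
    Subtype.ext (φ.symm.injective (congrArg Subtype.val huv))
  have hbij := (Nat.bijective_iff_injective_and_card s).2
    ⟨hs, le_antisymm (Nat.card_le_card_of_injective s hs) (hcardE.trans hcardW)⟩
  have hyW : φ y ∈ W := by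
    obtain ⟨u, hu⟩ := hbij.2 ⟨y, Subgroup.subset_closure (by simp)⟩
    have : φ.symm u = y := congrArg Subtype.val hu
    rw [← this, φ.apply_symm_apply]
    exact u.2
  have hxW : φ x ∈ W := mem_sup_left (mem_zpowers _)
  exact ⟨hcomm _ hxW _ hyW, hWE _ (mul_mem hxW hyW)⟩

theorem commute_and_symm_mul_mem {x y : G₁} (hx : x ^ p = 1) (hy : y ^ p = 1) :
    Commute (φ x) (φ y) ∧ φ.symm (φ x * φ y) ∈ Subgroup.closure {x, y} := by
  have hp := (Fact.out : p.Prime)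
  have hswap (h : Commute (φ y) (φ x) ∧ φ.symm (φ y * φ x) ∈ Subgroup.closure {y, x}) :
      Commute (φ x) (φ y) ∧ φ.symm (φ x * φ y) ∈ Subgroup.closure {x, y} := by
    rw [Set.pair_comm, h.1.symm.eq]
    exact ⟨h.1.symm, h.2⟩
  by_cases hc : PowComparable x y
  · rcases hc with h | h
    · exact commute_and_symm_mul_mem_of_mem_zpowers h₁ h₂ hφ hV hx hy h
    · exact hswap (commute_and_symm_mul_mem_of_mem_zpowers h₁ h₂ hφ hV hy hx h)
  have hne : x ≠ y := fun h => hc (h ▸ Or.inl (mem_zpowers _))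
  have hc' : ¬ PowComparable (φ x) (φ y) := by rwa [powComparable_map_iff hφ]
  set J := Subgroup.closure {φ x, φ y} with hJ
  have hxJ : φ x ∈ J := Subgroup.subset_closure (by simp)
  have hyJ : φ y ∈ J := Subgroup.subset_closure (by simp)
  have : Nontrivial J := ⟨⟨φ x, hxJ⟩, 1, fun h => hc' (Or.inl (by
    have h' : φ x = 1 := congrArg Subtype.val h
    exact h' ▸ one_mem _))⟩
  have := (h₂.to_subgroup J).center_nontrivial
  obtain ⟨⟨w, hw⟩, hw1⟩ := exists_ne (1 : center J)
  obtain ⟨z, hz, hz1, hzp⟩ := (h₂.to_subgroup J).exists_mem_zpowers_pow_eq_one (y := w)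
    fun h => hw1 (Subtype.ext h)
  have hzc : z ∈ center J := zpowers_le.2 hw hz
  have hcomm (g : G₂) (hg : g ∈ J) : Commute (z : G₂) g :=
    (congrArg Subtype.val (mem_center_iff.1 hzc ⟨g, hg⟩)).symm
  have hzp' : (z : G₂) ^ p = 1 := congrArg Subtype.val hzp
  have hz1' : (z : G₂) ≠ 1 := fun h => hz1 (Subtype.ext h)
  by_cases hzx : PowComparable (z : G₂) (φ x)
  · have hzy : ¬ PowComparable (z : G₂) (φ y) := by
      intro hzy
      have hfx := map_pow_eq_one h₁ h₂ hφ hV hx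
      have hfy := map_pow_eq_one h₁ h₂ hφ hV hy
      have h1 := hzx.symm.mem_zpowers hp hfx hz1'
      have h2 := hzy.symm.mem_zpowers hp hfy hz1'
      by_cases h : φ y = 1
      · exact hc' (Or.inr (h ▸ one_mem _))
      · exact hc' (Or.inl (zpowers_le.2 (mem_zpowers_symm hp h2 hzp' h) h1))
    refine hswap (commute_and_symm_mul_mem_of_commute h₁ h₂ hφ hV hy hx ?_ (z := z) ?_ hzp'
      (hcomm _ hyJ) hzy)
    · rw [Set.pair_comm]; exact (independent_pair_iff hne).2 hc
    · rw [Set.pair_comm]; exact z.2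
  · exact commute_and_symm_mul_mem_of_commute h₁ h₂ hφ hV hx hy ((independent_pair_iff hne).2 hc)
      z.2 hzp' (hcomm _ hxJ) hzx

theorem exists_subgroup_mem_iff (K : Subgroup G₁) : ∃ F : Subgroup G₂,
    (∀ g, g ∈ F ↔ g ^ p = 1 ∧ φ.symm g ∈ K) ∧
      Nat.card F = Nat.card ↥((powMonoidHom p : G₁ →* G₁).ker ⊓ K) := by
  have hφ1 := map_one_of_independent_iff hφ
  let F : Subgroup G₂ :=
    { carrier := {g | g ^ p = 1 ∧ φ.symm g ∈ K}
      one_mem' := ⟨one_pow p, by rw [φ.symm_apply_eq.2 hφ1.symm]; exact one_mem K⟩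
      mul_mem' := by
        rintro a b ⟨ha, ha'⟩ ⟨hb, hb'⟩
        have := commute_and_symm_mul_mem h₁ h₂ hφ hV (symm_pow_eq_one h₁ h₂ hφ hV ha)
          (symm_pow_eq_one h₁ h₂ hφ hV hb)
        rw [φ.apply_symm_apply, φ.apply_symm_apply] at this
        refine ⟨by rw [this.1.mul_pow, ha, hb, one_mul], ?_⟩
        refine ((Subgroup.closure_le K).2 ?_) this.2
        rintro _ (rfl | rfl) <;> assumption
      inv_mem' := by
        rintro a ⟨ha, ha'⟩
        have hai : a⁻¹ ^ p = 1 := by rw [inv_pow, ha, inv_one]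
        refine ⟨hai, zpowers_le.2 ha' (symm_mem_zpowers h₁ h₂ hφ hV hai ?_)⟩
        rw [φ.apply_symm_apply]
        exact inv_mem (mem_zpowers a) }
  refine ⟨F, fun g => Iff.rfl, (Nat.card_congr (φ.subtypeEquiv fun a => ?_)).symm⟩
  change a ^ p = 1 ∧ a ∈ K ↔ φ a ^ p = 1 ∧ φ.symm (φ a) ∈ K
  rw [φ.symm_apply_apply]
  exact and_congr_left fun _ =>
    ⟨map_pow_eq_one h₁ h₂ hφ hV, pow_eq_one_of_map_pow_eq_one h₁ h₂ hφ hV⟩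

theorem exists_subgroup_mem_iff_not_independent_insert {H : Subgroup G₂} {S : Set G₂}
    (hS : Independent S) (hSH : Subgroup.closure S = H) : ∃ F : Subgroup G₂,
    (∀ g, g ∈ F ↔ g ^ p = 1 ∧ (g ∈ H ∨ ¬ Independent (insert g S))) ∧
      p ^ S.ncard ≤ Nat.card F := by
  have hp := (Fact.out : p.Prime)
  have hφT : φ '' (φ ⁻¹' S) = S := Set.image_preimage_eq S φ.surjective
  have hT : Independent (φ ⁻¹' S) := by rwa [hφ, hφT]
  obtain ⟨F, hF, hcard⟩ :=
    exists_subgroup_mem_iff h₁ h₂ hφ hV (Subgroup.closure (φ ⁻¹' S))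
  refine ⟨F, fun g => ?_, ?_⟩
  · rw [hF]
    refine and_congr_right fun hg => ⟨fun h => ?_, fun h => ?_⟩
    · by_cases hgS : g ∈ S
      · exact Or.inl (hSH ▸ Subgroup.subset_closure hgS)
      · refine Or.inr fun hi => ?_
        have h' := not_independent_insert h (by simpa using hgS)
        rw [hφ, Set.image_insert_eq, hφT, φ.apply_symm_apply] at h'
        exact h' hi
    · rcases h with h | h
      · exact symm_mem_closure h₁ h₂ hφ hV hT hg (by rwa [hφT, hSH])
      · by_contra hc
        have h' := independent_insert_of_notMem_closure hp hT (symm_pow_eq_one h₁ h₂ hφ hV hg) hc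
        rw [hφ, Set.image_insert_eq, hφT, φ.apply_symm_apply] at h'
        exact h h'
  · have h := h₁.pow_ncard_le_card_ker_inf_closure hT
    rwa [← hcard, ← Set.ncard_image_of_injective _ φ.injective, hφT] at h

theorem pow_dgen_le_card_inf {B : Subgroup G₂} (hB : ∀ g, g ∈ B ↔ g ^ p = 1) (H : Subgroup G₂) :
    p ^ dgen H ≤ Nat.card ↥(H ⊓ B) := by
  have hp := (Fact.out : p.Prime)
  induction h : Nat.card H using Nat.strong_induction_on generalizing H with
  | _ N ih =>
  subst h
  by_cases hcase : ∃ M, M ⋖ H ∧ ∃ c ∈ H ⊓ B, c ∉ M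
  · obtain ⟨M, hM, c, hc, hcM⟩ := hcase
    have h1 := ih (Nat.card M)
      (((Nat.lt_mul_iff_one_lt_left Nat.card_pos).2 hp.one_lt).trans_le
        (h₂.mul_card_le_of_lt hM.lt)) M rfl
    have hlt : M ⊓ B < H ⊓ B := by
      refine lt_of_le_of_ne (inf_le_inf_right B hM.le) fun heq => hcM ?_
      rw [← heq] at hc
      exact hc.1
    have h2 := dgen_sup_zpowers_le M c
    rw [sup_zpowers_eq_of_covBy hM hc.1 hcM] at h2
    calc p ^ dgen H ≤ p ^ (dgen M + 1) := Nat.pow_le_pow_right hp.pos h2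
      _ = p * p ^ dgen M := pow_succ' _ _
      _ ≤ p * Nat.card ↥(M ⊓ B) := Nat.mul_le_mul_left p h1
      _ ≤ _ := h₂.mul_card_le_of_lt hlt
  · push Not at hcase
    obtain ⟨S, hSH, hn⟩ := exists_closure_eq_ncard_eq_dgen H
    have hS : Independent S := independent_of_ncard_le_dgen (by rw [hSH, hn])
    obtain ⟨F, hF, hcard⟩ := exists_subgroup_mem_iff_not_independent_insert h₁ h₂ hφ hV hS hSH
    rw [hn] at hcard
    refine hcard.trans ?_
    suffices hFH : F ≤ H from
      Nat.card_le_card_of_injective _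
        (inclusion_injective (le_inf hFH fun g hg => (hB g).2 ((hF g).1 hg).1))
    by_contra hFH
    have hconj : ∀ h ∈ H, ∀ g ∈ F, h * g * h⁻¹ ∈ F := by
      intro h hh g hg
      rw [hF] at hg ⊢
      refine ⟨by rw [conj_pow, hg.1, mul_one, mul_inv_cancel], ?_⟩
      by_cases hgH : g ∈ H
      · exact Or.inl (mul_mem (mul_mem hh hgH) (inv_mem hh))
      · refine Or.inr fun hi => ?_
        have hd := hg.2.resolve_left hgH
        have hcl (a : G₂) : Subgroup.closure (insert a S) = H ⊔ zpowers a := by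
          rw [Set.insert_eq, Subgroup.closure_union, hSH, ← zpowers_eq_closure, sup_comm]
        have heq : H ⊔ zpowers (h * g * h⁻¹) = H ⊔ zpowers g := by
          have hH (a : G₂) : h ∈ H ⊔ zpowers a := mem_sup_left hh
          refine le_antisymm (sup_le le_sup_left (zpowers_le.2 ?_))
            (sup_le le_sup_left (zpowers_le.2 ?_))
          · exact mul_mem (mul_mem (hH g) (mem_sup_right (mem_zpowers g))) (inv_mem (hH g))
          · have := mul_mem (mul_mem (inv_mem (hH (h * g * h⁻¹)))
              (mem_sup_right (mem_zpowers (h * g * h⁻¹)))) (hH _)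
            simpa [mul_assoc] using this
        have h1 := h₂.ncard_le_dgen_of_independent hi
        have hnot : h * g * h⁻¹ ∉ S := by
          intro hS'
          have := mul_mem (mul_mem (inv_mem hh) (hSH ▸ Subgroup.subset_closure hS' :
            h * g * h⁻¹ ∈ H)) hh
          exact hgH (by simpa [mul_assoc] using this)
        rw [Set.ncard_insert_of_notMem hnot, hcl, heq, ← hcl] at h1
        exact hd (independent_of_ncard_le_dgen ((Set.ncard_insert_le g S).trans h1))
    obtain ⟨f₀, hf₀, hf₀H, hf₀n⟩ := h₂.exists_mem_conj_mem (left_lt_sup.2 hFH)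
    have hHF : H ≤ normalizer (F : Set G₂) := fun h hh =>
      mem_normalizer_fintype (S := (F : Set G₂)) (hconj h hh)
    rw [← SetLike.mem_coe, coe_mul_of_left_le_normalizer_right H F hHF, Set.mem_mul] at hf₀
    obtain ⟨h, hh, f, hf, rfl⟩ := hf₀
    have hfH : f ∉ H := fun h' => hf₀H (mul_mem hh h')
    have hfn : ∀ x ∈ H, f * x * f⁻¹ ∈ H := by
      intro x hx
      have := mul_mem (mul_mem (inv_mem hh) (hf₀n x hx)) hh
      simpa [mul_assoc] using this
    have hfp := ((hF f).1 hf).1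
    obtain ⟨s, hs, hmem⟩ : ∃ s ∈ S, s ∈ Subgroup.closure (insert f (S \ {s})) := by
      have hd := ((hF f).1 hf).2.resolve_left hfH
      unfold Independent at hd
      push Not at hd
      obtain ⟨s, hs, hmem⟩ := hd
      have hfS : f ∉ S := fun h => hfH (hSH ▸ Subgroup.subset_closure h)
      rcases hs with rfl | hs
      · refine absurd ?_ hfH
        rw [← hSH]
        simpa [hfS] using hmem
      · have hfs : f ∉ ({s} : Set G₂) := fun h' => hfS (Set.mem_singleton_iff.1 h' ▸ hs)
        exact ⟨s, hs, by rwa [Set.insert_sdiff_of_notMem _ hfs] at hmem⟩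
    have hlt : Subgroup.closure (S \ {s}) < H := by
      refine lt_of_le_of_ne (hSH ▸ Subgroup.closure_mono Set.sdiff_subset) fun heq => hS s hs ?_
      rw [heq, ← hSH]
      exact Subgroup.subset_closure hs
    obtain ⟨M, hSM, hM⟩ := exists_le_covBy_of_lt hlt
    have hfM : ∀ l ∈ M, f * l * f⁻¹ ∈ M := by
      intro l hl
      have hlH := hM.le hl
      have hcF : f * (l * f⁻¹ * l⁻¹) ∈ F := mul_mem hf (hconj l hlH _ (inv_mem hf))
      have hcH : f * (l * f⁻¹ * l⁻¹) ∈ H := by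
        simpa [mul_assoc] using mul_mem (hfn l hlH) (inv_mem hlH)
      have := mul_mem (hcase M hM _ ⟨hcH, (hB _).2 ((hF _).1 hcF).1⟩) hl
      simpa [mul_assoc] using this
    have hsM : s ∈ M ⊔ zpowers f := by
      rw [Set.insert_eq, Subgroup.closure_union, ← zpowers_eq_closure, sup_comm] at hmem
      exact sup_le_sup_right hSM _ hmem
    obtain ⟨l, hl, k, hk⟩ := (mem_sup_zpowers hfM).1 hsM
    have hsH : s ∈ H := hSH ▸ Subgroup.subset_closure hs
    by_cases hd : (p : ℤ) ∣ k
    · rw [zpow_eq_one_of_dvd hd hfp, mul_one] at hk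
      refine hM.lt.not_ge ?_
      rw [← hSH, Subgroup.closure_le]
      intro x hx
      by_cases hxs : x = s
      · rw [hxs, hk]; exact hl
      · exact hSM (Subgroup.subset_closure ⟨hx, hxs⟩)
    · refine hfH (mem_of_zpow_mem_of_not_dvd hp hd (hfp ▸ one_mem _) ?_)
      rw [eq_inv_mul_of_mul_eq hk.symm]
      exact mul_mem (inv_mem (hM.le hl)) hsH

end LargeTorsion

theorem dgen_le_one_of_card_ker_le (h₁ : IsPGroup p G₁)
    (hφ : ∀ X : Set G₁, Independent X ↔ Independent (φ '' X))
    (hV : Nat.card (powMonoidHom p : G₁ →* G₁).ker ≤ p) (H : Subgroup G₂) : dgen H ≤ 1 := by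
  have hp := (Fact.out : p.Prime)
  obtain ⟨S, hSH, hn⟩ := exists_closure_eq_ncard_eq_dgen H
  have hS : Independent S := independent_of_ncard_le_dgen (by rw [hSH, hn])
  have hφT : φ '' (φ ⁻¹' S) = S := Set.image_preimage_eq S φ.surjective
  have h := h₁.pow_ncard_le_card_ker_inf_closure (T := φ ⁻¹' S) (by rwa [hφ, hφT])
  rw [← Set.ncard_image_of_injective _ φ.injective, hφT, hn] at h
  refine (Nat.pow_le_pow_iff_right hp.one_lt).1 ?_
  rw [pow_one]
  exact (h.trans (Nat.card_le_card_of_injective _ (inclusion_injective inf_le_left))).trans hV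

end Bijection

theorem dgen_le_dgen_omega_one
    (p : ℕ) (hp : p.Prime) (G₁ G₂ : Type) [CommGroup G₁] [Finite G₁]
    [Group G₂] [Finite G₂] (h₁ : IsPGroup p G₁) (h₂ : IsPGroup p G₂)
    (φ : G₁ ≃ G₂) (hφ : ∀ X : Set G₁, Independent X ↔ Independent (φ '' X)) :
    ∀ H : Subgroup G₂,
      dgen H ≤ dgen (Subgroup.closure {x : G₂ | x ∈ H ∧ x ^ p = 1}) := by
  have : Fact p.Prime := ⟨hp⟩
  intro H
  obtain ⟨Y, hY, hn⟩ :=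
    exists_closure_eq_ncard_eq_dgen (Subgroup.closure {x : G₂ | x ∈ H ∧ x ^ p = 1})
  rcases lt_or_ge p (Nat.card (powMonoidHom p : G₁ →* G₁).ker) with hV | hV
  · obtain ⟨B, hB', -⟩ := exists_subgroup_mem_iff h₁ h₂ hφ hV ⊤
    have hB : ∀ g, g ∈ B ↔ g ^ p = 1 := by simpa using hB'
    have hHB : Subgroup.closure {x : G₂ | x ∈ H ∧ x ^ p = 1} = H ⊓ B := by
      rw [← Subgroup.closure_eq (H ⊓ B)]
      congr 1
      ext x
      simp [hB]
    have hYB : ∀ a ∈ Subgroup.closure Y, a ^ p = 1 := fun a ha => by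
      rw [hY, hHB] at ha
      exact (hB a).1 ha.2
    have hle := card_closure_le_pow hp.pos (fun a ha b hb => by
      have := (commute_and_symm_mul_mem h₁ h₂ hφ hV (symm_pow_eq_one h₁ h₂ hφ hV (hYB a ha))
        (symm_pow_eq_one h₁ h₂ hφ hV (hYB b hb))).1
      rwa [φ.apply_symm_apply, φ.apply_symm_apply] at this)
      fun y hy => hYB y (Subgroup.subset_closure hy)
    rw [← hn]
    refine (Nat.pow_le_pow_iff_right hp.one_lt).1
      ((pow_dgen_le_card_inf h₁ h₂ hφ hV hB H).trans ?_)
    rwa [hY, hHB] at hle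
  · rcases Nat.eq_zero_or_pos (dgen H) with h0 | hpos
    · rw [h0]; exact Nat.zero_le _
    refine (dgen_le_one_of_card_ker_le h₁ hφ hV H).trans (Nat.one_le_iff_ne_zero.2 fun h0 => ?_)
    rw [h0, Set.ncard_eq_zero] at hn
    rw [hn, Subgroup.closure_empty] at hY
    obtain ⟨y, hy, hy1⟩ : ∃ y ∈ H, y ≠ 1 := by
      by_contra! h
      have hbot : Subgroup.closure (∅ : Set G₂) = H := by
        rw [Subgroup.closure_empty]
        exact ((Subgroup.eq_bot_iff_forall H).2 h).symm
      have := dgen_le_ncard hbot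
      rw [Set.ncard_empty] at this
      omega
    obtain ⟨e, he, he1, hep⟩ := h₂.exists_mem_zpowers_pow_eq_one hy1
    refine he1 (Subgroup.mem_bot.1 (hY ▸ Subgroup.subset_closure ⟨?_, hep⟩))
    exact Subgroup.zpowers_le.2 hy he
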